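/- Let U ⊆ ℝⁿ be open, let f : U → ℝⁿ be continuously differentiable, and for x ∈ U let λ₁(x) ≥ λ₂(x) ≥ … ≥ λₙ(x) denote the eigenvalues (with multiplicity, in decreasing order) of the symmetric matrix Df(x) + Df(x)ᵀ. Let K ⊆ U be a compact set invariant under the flow of f (there is φ : ℝ × ℝⁿ → ℝⁿ with φ(0, x) = x and ∂φ/∂t(t, x) = f(φ(t, x)) for x ∈ K and all t ∈ ℝ, with φ(t, ·) mapping K onto K for every t). Suppose there exist a continuously differentiable function v : U → ℝ, k ∈ {1, …, n−1}, and s ∈ [0, 1] such that λ₁(x) + ⋯ + λ_k(x) + s·λ_{k+1}(x) + ⟨∇v(x), f(x)⟩ < 0 for all x ∈ U. Then the Hausdorff dimension of K satisfies dim_H K < k + s. -/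

import Mathlib

open Filter Topology Matrix

/-- The Jacobian matrix of a vector field `f : ℝⁿ → ℝⁿ` at a point `x`:
`(Df(x))ᵢⱼ = ∂fᵢ/∂xⱼ (x)`. -/
noncomputable def jacobian {n : ℕ}
    (f : EuclideanSpace ℝ (Fin n) → EuclideanSpace ℝ (Fin n))
    (x : EuclideanSpace ℝ (Fin n)) : Matrix (Fin n) (Fin n) ℝ :=
  Matrix.of fun i j => fderiv ℝ f x (EuclideanSpace.single j 1) i
/-- An antitone family of reals is determined by the polynomial having it as its roots. -/
theorem Antitone.eq_of_prod_X_sub_C_eq {n : ℕ} {a b : Fin n → ℝ} (ha : Antitone a)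
    (hb : Antitone b)
    (h : ∏ i, (Polynomial.X - Polynomial.C (a i)) = ∏ i, (Polynomial.X - Polynomial.C (b i))) :
    a = b := by
  have key : ∀ c : Fin n → ℝ,
      (∏ i, (Polynomial.X - Polynomial.C (c i))).roots = Multiset.map c Finset.univ.val := by
    intro c
    rw [Polynomial.roots_prod]
    · simp
    · simp [Finset.prod_ne_zero_iff, Polynomial.X_sub_C_ne_zero]
  have h' := congrArg Polynomial.roots h
  rw [key, key, Fin.univ_val_map, Fin.univ_val_map, Multiset.coe_eq_coe] at h'
  exact List.ofFn_injective
    (h'.eq_of_pairwise' ha.sortedGE_ofFn.pairwise hb.sortedGE_ofFn.pairwise)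

/-- The quadratic form of `Df + Dfᵀ` is diagonal in an orthonormal basis, with the prescribed
eigenvalues in the prescribed order. -/
theorem exists_orthonormalBasis_two_mul_inner_fderiv {n : ℕ}
    (f : EuclideanSpace ℝ (Fin n) → EuclideanSpace ℝ (Fin n)) (x : EuclideanSpace ℝ (Fin n))
    (l : Fin n → ℝ) (hl : Antitone l)
    (h : (jacobian f x + (jacobian f x)ᵀ).charpoly =
      ∏ i : Fin n, (Polynomial.X - Polynomial.C (l i))) :
    ∃ b : OrthonormalBasis (Fin n) ℝ (EuclideanSpace ℝ (Fin n)),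
      ∀ u, 2 * inner ℝ u (fderiv ℝ f x u) = ∑ i, l i * inner ℝ (b i) u ^ 2 := by
  set S := jacobian f x + (jacobian f x)ᵀ with hS
  have hSh : S.IsHermitian := by
    rw [Matrix.IsHermitian, Matrix.conjTranspose_eq_transpose_of_trivial, hS]
    simp [add_comm]
  have hT := Matrix.isSymmetric_toEuclideanLin_iff.mpr hSh
  have hn : Module.finrank ℝ (EuclideanSpace ℝ (Fin n)) = n := finrank_euclideanSpace_fin
  have heig : hT.eigenvalues hn = l := by
    apply (hT.eigenvalues_antitone hn).eq_of_prod_X_sub_C_eq hl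
    rw [← h, ← Matrix.charpoly_toLin S (EuclideanSpace.basisFun (Fin n) ℝ).toBasis]
    rw [Matrix.toEuclideanLin_eq_toLin_orthonormal] at hT
    exact ((Matrix.isSymmetric_toEuclideanLin_iff.mpr hSh).charpoly_eq hn).symm.trans
      (by rw [Matrix.toEuclideanLin_eq_toLin_orthonormal])
  have hJ : Matrix.toEuclideanLin (jacobian f x) = (fderiv ℝ f x : _ →ₗ[ℝ] _) := by
    apply (EuclideanSpace.basisFun (Fin n) ℝ).toBasis.ext
    intro j
    ext i
    simp [jacobian]
  have hJt : ∀ u, inner ℝ u (Matrix.toEuclideanLin (jacobian f x)ᵀ u)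
      = inner ℝ u (fderiv ℝ f x u) := by
    intro u
    rw [← Matrix.conjTranspose_eq_transpose_of_trivial,
      Matrix.toEuclideanLin_conjTranspose_eq_adjoint, LinearMap.adjoint_inner_right, hJ,
      real_inner_comm]
    rfl
  refine ⟨hT.eigenvectorBasis hn, fun u => ?_⟩
  have h1 : 2 * inner ℝ u (fderiv ℝ f x u) = inner ℝ u (Matrix.toEuclideanLin S u) := by
    rw [hS, map_add, LinearMap.add_apply, inner_add_right, hJt, hJ]
    simp only [ContinuousLinearMap.coe_coe]
    ring
  rw [h1, ← (hT.eigenvectorBasis hn).sum_inner_mul_inner]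
  refine Finset.sum_congr rfl fun i _ => ?_
  rw [← hT, hT.apply_eigenvectorBasis hn, heig, inner_smul_left, real_inner_comm]
  simp
  ring

/-- The Ky Fan maximum principle, upper bound. -/
theorem sum_inner_le_sum_eigenvalues {n j : ℕ} (hj : j ≤ n)
    {J : EuclideanSpace ℝ (Fin n) →L[ℝ] EuclideanSpace ℝ (Fin n)} {l : Fin n → ℝ}
    (hl : Antitone l) (b : OrthonormalBasis (Fin n) ℝ (EuclideanSpace ℝ (Fin n)))
    (hb : ∀ u, 2 * inner ℝ u (J u) = ∑ i, l i * inner ℝ (b i) u ^ 2)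
    {q : Fin j → EuclideanSpace ℝ (Fin n)} (hq : Orthonormal ℝ q) :
    ∑ a, 2 * inner ℝ (q a) (J (q a)) ≤ ∑ i : Fin j, l (Fin.castLE hj i) := by
  rcases Nat.eq_zero_or_pos j with rfl | hj0
  · simp
  set w : Fin n → ℝ := fun i => ∑ a, inner ℝ (b i) (q a) ^ 2 with hw
  have hw0 : ∀ i, 0 ≤ w i := fun i => Finset.sum_nonneg fun a _ => sq_nonneg _
  have hw1 : ∀ i, w i ≤ 1 := by
    intro i
    have := hq.sum_inner_products_le (b i) (s := Finset.univ)
    simpa [hw, real_inner_comm] using this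
  have hws : ∑ i, w i = j := by
    rw [hw, Finset.sum_comm]
    have : ∀ a, ∑ i, inner ℝ (b i) (q a) ^ 2 = 1 := by
      intro a
      have := b.sum_sq_norm_inner_right (q a)
      simpa [hq.1 a] using this
    simp [this]
  set m := l ⟨j - 1, by omega⟩ with hm
  have h1 : ∑ a, 2 * inner ℝ (q a) (J (q a)) = ∑ i, l i * w i := by
    simp_rw [hb, hw, Finset.mul_sum]
    rw [Finset.sum_comm]
  have h2 : ∑ i : Fin j, l (Fin.castLE hj i) = ∑ i : Fin n, if i.val < j then l i else 0 := by
    rw [← Finset.sum_filter]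
    refine Finset.sum_bij (fun i _ => Fin.castLE hj i) ?_ ?_ ?_ ?_
    · simp
    · intro a _ c _ h
      simpa [Fin.ext_iff] using h
    · intro i hi
      simp only [Finset.mem_filter, Finset.mem_univ, true_and] at hi
      exact ⟨⟨i, hi⟩, by simp, by simp⟩
    · simp
  have h3 : ∑ i : Fin n, (if i.val < j then (1 : ℝ) else 0) = j := by
    rw [← Finset.sum_filter, Finset.sum_const, nsmul_eq_mul, mul_one]
    congr 1
    have : (Finset.univ.filter fun i : Fin n => i.val < j)
        = Finset.univ.map (Fin.castLEEmb hj) := by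
      ext i
      simp only [Finset.mem_filter, Finset.mem_univ, true_and, Finset.mem_map]
      exact ⟨fun h => ⟨⟨i, h⟩, by simp⟩, by rintro ⟨a, rfl⟩; simp⟩
    rw [this]
    simp
  rw [h1, h2]
  have h4 : ∑ i, (l i - m) * (w i - if i.val < j then (1 : ℝ) else 0) ≤ 0 := by
    refine Finset.sum_nonpos fun i _ => ?_
    split_ifs with hi
    · refine mul_nonpos_of_nonneg_of_nonpos ?_ (by linarith [hw1 i])
      exact sub_nonneg.mpr (hl (Fin.mk_le_mk.mpr (by omega) : i ≤ ⟨j - 1, by omega⟩))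
    · refine mul_nonpos_of_nonpos_of_nonneg ?_ (by simpa using hw0 i)
      exact sub_nonpos.mpr (hl (Fin.mk_le_mk.mpr (by omega) : (⟨j - 1, by omega⟩ : Fin n) ≤ i))
  have h5 : ∑ i, (l i - m) * (w i - if i.val < j then (1 : ℝ) else 0) =
      ∑ i, l i * w i - (∑ i : Fin n, if i.val < j then l i else 0) -
      m * (∑ i, w i - ∑ i : Fin n, if i.val < j then (1 : ℝ) else 0) := by
    rw [← Finset.sum_sub_distrib, ← Finset.sum_sub_distrib, Finset.mul_sum,
      ← Finset.sum_sub_distrib]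
    refine Finset.sum_congr rfl fun i _ => ?_
    split_ifs <;> ring
  rw [h5, hws, h3] at h4
  linarith

/-- The Ky Fan maximum principle, the maximum is attained. -/
theorem sum_inner_eq_sum_eigenvalues {n j : ℕ} (hj : j ≤ n)
    {J : EuclideanSpace ℝ (Fin n) →L[ℝ] EuclideanSpace ℝ (Fin n)} {l : Fin n → ℝ}
    (b : OrthonormalBasis (Fin n) ℝ (EuclideanSpace ℝ (Fin n)))
    (hb : ∀ u, 2 * inner ℝ u (J u) = ∑ i, l i * inner ℝ (b i) u ^ 2) :
    ∑ a : Fin j, 2 * inner ℝ (b (Fin.castLE hj a)) (J (b (Fin.castLE hj a))) =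
      ∑ i : Fin j, l (Fin.castLE hj i) := by
  refine Finset.sum_congr rfl fun a _ => ?_
  rw [hb, Finset.sum_eq_single (Fin.castLE hj a)]
  · simp
  · intro i _ hi
    simp [b.inner_eq_zero hi]
  · simp

/-- `GramBound j A a`: the operator `A` multiplies the squared volume of every `j`-dimensional
parallelepiped by at most `exp a`. -/
def GramBound {n : ℕ} (j : ℕ) (A : EuclideanSpace ℝ (Fin n) →L[ℝ] EuclideanSpace ℝ (Fin n))
    (a : ℝ) : Prop :=
  ∀ y : Fin j → EuclideanSpace ℝ (Fin n),
    (Matrix.gram ℝ fun i => A (y i)).det ≤ Real.exp a * (Matrix.gram ℝ y).det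

theorem GramBound.id {n j : ℕ} :
    GramBound j (ContinuousLinearMap.id ℝ (EuclideanSpace ℝ (Fin n))) 0 := by
  intro y
  simp

theorem GramBound.comp {n j : ℕ}
    {A B : EuclideanSpace ℝ (Fin n) →L[ℝ] EuclideanSpace ℝ (Fin n)} {a b : ℝ}
    (hA : GramBound j A a) (hB : GramBound j B b) : GramBound j (A.comp B) (a + b) := by
  intro y
  refine (hA fun i => B (y i)).trans ?_
  rw [Real.exp_add, mul_assoc]
  exact mul_le_mul_of_nonneg_left (hB y) (Real.exp_pos _).le

theorem Matrix.PosSemidef.det_le_exp_trace_sub {ι : Type*} [Fintype ι] [DecidableEq ι]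
    {M : Matrix ι ι ℝ} (hM : M.PosSemidef) : M.det ≤ Real.exp (M.trace - Fintype.card ι) := by
  have h1 := hM.isHermitian.det_eq_prod_eigenvalues
  have h2 := hM.isHermitian.trace_eq_sum_eigenvalues
  have h3 : M.trace - Fintype.card ι = ∑ i, (hM.isHermitian.eigenvalues i - 1) := by
    rw [h2]; simp
  rw [h3, Real.exp_sum, h1]
  refine Finset.prod_le_prod (fun i _ => hM.eigenvalues_nonneg i) fun i _ => ?_
  have := Real.add_one_le_exp (hM.isHermitian.eigenvalues i - 1)
  simpa using this

theorem gramBound_of_orthonormal {n j : ℕ}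
    {A : EuclideanSpace ℝ (Fin n) →L[ℝ] EuclideanSpace ℝ (Fin n)} {a : ℝ}
    (h : ∀ q : Fin j → EuclideanSpace ℝ (Fin n), Orthonormal ℝ q →
      (Matrix.gram ℝ fun i => A (q i)).det ≤ Real.exp a) : GramBound j A a := by
  intro y
  by_cases hy : LinearIndependent ℝ y
  · have hfin : Module.finrank ℝ (Submodule.span ℝ (Set.range y)) = j := by
      rw [finrank_span_eq_card hy, Fintype.card_fin]
    set q₀ := (stdOrthonormalBasis ℝ (Submodule.span ℝ (Set.range y))).reindex (finCongr hfin)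
    set q : Fin j → EuclideanSpace ℝ (Fin n) := fun i => (q₀ i : EuclideanSpace ℝ (Fin n))
    have hq : Orthonormal ℝ q := q₀.orthonormal.comp_linearIsometry (Submodule.subtypeₗᵢ _)
    set R : Matrix (Fin j) (Fin j) ℝ := Matrix.of fun i c => inner ℝ (q i) (y c) with hR
    have hyq : ∀ c, y c = ∑ i, R i c • q i := by
      intro c
      have := q₀.sum_repr' ⟨y c, Submodule.subset_span ⟨c, rfl⟩⟩
      have := congrArg (Subtype.val) this
      simpa [q, R] using this.symm
    have key : ∀ B : EuclideanSpace ℝ (Fin n) →L[ℝ] EuclideanSpace ℝ (Fin n),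
        (Matrix.gram ℝ fun i => B (y i)) = Rᵀ * (Matrix.gram ℝ fun i => B (q i)) * R := by
      intro B
      ext c d
      rw [Matrix.gram_apply, hyq c, hyq d, map_sum, map_sum]
      simp only [map_smul, sum_inner, inner_sum, inner_smul_left, inner_smul_right,
        Matrix.mul_apply, Matrix.transpose_apply, Matrix.gram_apply, Finset.sum_mul,
        Finset.mul_sum]
      refine Finset.sum_congr rfl fun i _ => Finset.sum_congr rfl fun i' _ => ?_
      simp
      ring
    have key1 := key (ContinuousLinearMap.id ℝ _)
    simp only [ContinuousLinearMap.id_apply] at key1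
    rw [key A, show Matrix.gram ℝ y = _ from key1,
      show Matrix.gram ℝ q = 1 from Matrix.gram_eq_one_iff_orthonormal.mpr hq]
    simp only [Matrix.det_mul, Matrix.det_transpose, Matrix.det_one]
    nlinarith [h q hq, sq_nonneg R.det]
  · have hAy : ¬ LinearIndependent ℝ fun i => A (y i) := fun hA =>
      hy (LinearIndependent.of_comp A.toLinearMap hA)
    have h1 : (Matrix.gram ℝ y).det = 0 := by
      by_contra h0
      exact hy (Matrix.linearIndependent_of_det_gram_ne_zero h0)
    have h2 : (Matrix.gram ℝ fun i => A (y i)).det = 0 := by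
      by_contra h0
      exact hAy (Matrix.linearIndependent_of_det_gram_ne_zero h0)
    rw [h1, h2, mul_zero]

/-- Infinitesimal volume growth. -/
theorem gramBound_id_add_smul {n j : ℕ}
    {J : EuclideanSpace ℝ (Fin n) →L[ℝ] EuclideanSpace ℝ (Fin n)} {L M h : ℝ} (hh : 0 ≤ h)
    (hJ : ‖J‖ ≤ M)
    (hL : ∀ q : Fin j → EuclideanSpace ℝ (Fin n), Orthonormal ℝ q →
      ∑ a, 2 * inner ℝ (q a) (J (q a)) ≤ L) :
    GramBound j (ContinuousLinearMap.id ℝ _ + h • J) (h * L + h ^ 2 * j * M ^ 2) := by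
  apply gramBound_of_orthonormal
  intro q hq
  refine (Matrix.posSemidef_gram ℝ _).det_le_exp_trace_sub.trans (Real.exp_le_exp.mpr ?_)
  have h1 : ∀ a, inner ℝ (q a + h • J (q a)) (q a + h • J (q a)) ≤
      1 + h * (2 * inner ℝ (q a) (J (q a))) + h ^ 2 * M ^ 2 := by
    intro a
    rw [real_inner_self_eq_norm_sq, norm_add_sq_real, hq.1 a, inner_smul_right, norm_smul,
      mul_pow, Real.norm_eq_abs, sq_abs]
    have h2 : ‖J (q a)‖ ≤ M := by
      refine (J.le_opNorm _).trans ?_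
      rw [hq.1 a, mul_one]
      exact hJ
    have h3 : ‖J (q a)‖ ^ 2 ≤ M ^ 2 := by gcongr
    nlinarith [mul_le_mul_of_nonneg_left h3 (sq_nonneg h)]
  have h2 : (Matrix.gram ℝ fun i =>
      (ContinuousLinearMap.id ℝ (EuclideanSpace ℝ (Fin n)) + h • J) (q i)).trace ≤
      ∑ a : Fin j, (1 + h * (2 * inner ℝ (q a) (J (q a))) + h ^ 2 * M ^ 2) := by
    refine Finset.sum_le_sum fun a _ => ?_
    simpa [Matrix.gram_apply] using h1 a
  rw [Finset.sum_add_distrib, Finset.sum_add_distrib, ← Finset.mul_sum] at h2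
  simp only [Finset.sum_const, Finset.card_univ, Fintype.card_fin, nsmul_eq_mul, mul_one] at h2
  rw [Fintype.card_fin]
  nlinarith [mul_le_mul_of_nonneg_left (hL q hq) hh]

/-- Singular value decomposition of an operator bounded from below. -/
theorem exists_singularValueDecomposition {n : ℕ}
    (A : EuclideanSpace ℝ (Fin n) →L[ℝ] EuclideanSpace ℝ (Fin n)) {m : ℝ} (hm : 0 < m)
    (hA : ∀ w, m * ‖w‖ ≤ ‖A w‖) :
    ∃ (e u : OrthonormalBasis (Fin n) ℝ (EuclideanSpace ℝ (Fin n))) (α : Fin n → ℝ),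
      Antitone α ∧ (∀ i, m ≤ α i) ∧ ∀ i, A (e i) = α i • u i := by
  have hT : (A.adjoint.comp A).toLinearMap.IsSymmetric := by
    intro x y
    simp [ContinuousLinearMap.adjoint_inner_left, ContinuousLinearMap.adjoint_inner_right]
  have hn : Module.finrank ℝ (EuclideanSpace ℝ (Fin n)) = n := finrank_euclideanSpace_fin
  set e := hT.eigenvectorBasis hn with he
  set μ := hT.eigenvalues hn with hμ
  have hin : ∀ i w, inner ℝ (A (e i)) (A w) = μ i * inner ℝ (e i) w := by
    intro i w
    have h1 := hT.apply_eigenvectorBasis hn i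
    have h2 : inner ℝ (A (e i)) (A w) = inner ℝ (A.adjoint (A (e i))) w := by
      rw [ContinuousLinearMap.adjoint_inner_left]
    rw [h2, show A.adjoint (A (e i)) = μ i • e i from h1, inner_smul_left]
    simp
  have hnorm : ∀ i, ‖A (e i)‖ ^ 2 = μ i := by
    intro i
    rw [← real_inner_self_eq_norm_sq, hin, real_inner_self_eq_norm_sq, e.orthonormal.1 i]
    simp
  have hlow : ∀ i, m ≤ ‖A (e i)‖ := by
    intro i
    simpa [e.orthonormal.1 i] using hA (e i)
  have hpos : ∀ i, 0 < ‖A (e i)‖ := fun i => hm.trans_le (hlow i)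
  have hu : Orthonormal ℝ fun i => ‖A (e i)‖⁻¹ • A (e i) := by
    rw [orthonormal_iff_ite]
    intro i l
    rw [inner_smul_left, inner_smul_right, hin, orthonormal_iff_ite.mp e.orthonormal]
    split_ifs with h
    · subst h
      have := (hpos i).ne'
      rw [← hnorm]
      simp
      field_simp
    · simp
  obtain ⟨u, hu'⟩ := Orthonormal.exists_orthonormalBasis_extension_of_card_eq
    (ι := Fin n) (𝕜 := ℝ) (E := EuclideanSpace ℝ (Fin n)) (by simp)
    (v := fun i => ‖A (e i)‖⁻¹ • A (e i)) (s := Set.univ) (hu.comp _ Subtype.val_injective)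
  refine ⟨e, u, fun i => ‖A (e i)‖, ?_, hlow, fun i => ?_⟩
  · intro i l hil
    have := hT.eigenvalues_antitone hn hil
    rw [← hμ, ← hnorm, ← hnorm] at this
    exact le_of_sq_le_sq this (norm_nonneg _)
  · rw [hu' i (Set.mem_univ i), smul_smul, mul_inv_cancel₀ (hpos i).ne', one_smul]

theorem GramBound.prod_le {n j : ℕ} (hj : j ≤ n)
    {A : EuclideanSpace ℝ (Fin n) →L[ℝ] EuclideanSpace ℝ (Fin n)} {a : ℝ} (h : GramBound j A a)
    {e u : OrthonormalBasis (Fin n) ℝ (EuclideanSpace ℝ (Fin n))} {α : Fin n → ℝ}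
    (hα : ∀ i, A (e i) = α i • u i) :
    ∏ i : Fin j, α (Fin.castLE hj i) ≤ Real.exp (a / 2) := by
  have h1 := h fun i => e (Fin.castLE hj i)
  have h2 : Matrix.gram ℝ (fun i => e (Fin.castLE hj i)) = 1 :=
    Matrix.gram_eq_one_iff_orthonormal.mpr
      (e.orthonormal.comp _ (Fin.castLE_injective hj))
  have h3 : (Matrix.gram ℝ fun i => A (e (Fin.castLE hj i))) =
      Matrix.diagonal fun i : Fin j => α (Fin.castLE hj i) ^ 2 := by
    ext i l
    rw [Matrix.gram_apply, hα, hα, inner_smul_left, inner_smul_right,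
      orthonormal_iff_ite.mp u.orthonormal, Matrix.diagonal_apply]
    by_cases hil : i = l
    · subst hil
      simp [sq]
    · simp [hil]
  rw [h2, h3, Matrix.det_diagonal, Matrix.det_one, mul_one, Finset.prod_pow] at h1
  refine le_of_sq_le_sq (h1.trans_eq ?_) (Real.exp_pos _).le
  rw [← Real.exp_nat_mul]
  congr 1
  push_cast
  ring

/-- A set close to the image of a ball of radius `r` under `A` is covered by finitely many balls
centred in it whose `(k + s)`-dimensional content is controlled by the volume growth of `A`. -/
theorem exists_finset_cover {n k : ℕ} (hkn : k < n) {s : ℝ} (hs : s ∈ Set.Icc (0 : ℝ) 1)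
    (A : EuclideanSpace ℝ (Fin n) →L[ℝ] EuclideanSpace ℝ (Fin n)) {m : ℝ} (hm : 0 < m)
    (hA : ∀ w, m * ‖w‖ ≤ ‖A w‖) {a₀ a₁ : ℝ} (h₀ : GramBound k A a₀)
    (h₁ : GramBound (k + 1) A a₁) (S : Set (EuclideanSpace ℝ (Fin n)))
    (p : EuclideanSpace ℝ (Fin n)) {r : ℝ} (hr : 0 < r)
    (hS : ∀ w ∈ S, ∃ z, ‖z‖ ≤ r ∧ ‖w - p - A z‖ ≤ m * r) :
    ∃ t : Finset (EuclideanSpace ℝ (Fin n) × ℝ),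
      (∀ c ∈ t, c.1 ∈ S ∧ 0 < c.2) ∧ (S ⊆ ⋃ c ∈ t, Metric.closedBall c.1 c.2) ∧
      ∑ c ∈ t, c.2 ^ (k + s) ≤
        (16 * n : ℝ) ^ n * Real.exp (((1 - s) * a₀ + s * a₁) / 2) * r ^ (k + s) := by
  classical
  obtain ⟨e, u, α, hαa, hαm, hAe⟩ := exists_singularValueDecomposition A hm hA
  have hαpos : ∀ i, 0 < α i := fun i => hm.trans_le (hαm i)
  have hP₀ := h₀.prod_le hkn.le hAe
  have hP₁ := h₁.prod_le hkn hAe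
  set κ : Fin n := ⟨k, hkn⟩ with hκ
  rw [Fin.prod_univ_castSucc] at hP₁
  have hlast : Fin.castLE hkn (Fin.last k) = κ := rfl
  rw [hlast] at hP₁
  have hcs : ∀ i : Fin k, Fin.castLE hkn i.castSucc = Fin.castLE hkn.le i := fun i => rfl
  simp only [hcs] at hP₁
  set P := ∏ i : Fin k, α (Fin.castLE hkn.le i) with hP
  have hPpos : 0 < P := Finset.prod_pos fun i _ => hαpos _
  have hinner : ∀ i z, inner ℝ (u i) (A z) = α i * inner ℝ (e i) z := by
    intro i z
    conv_lhs => rw [← e.sum_repr' z]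
    rw [map_sum, inner_sum, Finset.sum_eq_single i]
    · rw [map_smul, hAe, inner_smul_right, inner_smul_right, real_inner_self_eq_norm_sq,
        u.orthonormal.1 i]
      ring
    · intro l _ hl
      rw [map_smul, hAe, inner_smul_right, inner_smul_right, u.inner_eq_zero (Ne.symm hl)]
      ring
    · simp
  have hcoord : ∀ w ∈ S, ∀ i, |inner ℝ (u i) (w - p)| ≤ 2 * α i * r := by
    intro w hw i
    obtain ⟨z, hz, hz'⟩ := hS w hw
    have e1 : inner ℝ (u i) (w - p) = α i * inner ℝ (e i) z + inner ℝ (u i) (w - p - A z) := by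
      rw [inner_sub_right (u i) (w - p) (A z), hinner]
      ring
    have e2 : |inner ℝ (e i) z| ≤ r := by
      refine (abs_real_inner_le_norm _ _).trans ?_
      rw [e.orthonormal.1 i, one_mul]
      exact hz
    have e3 : |inner ℝ (u i) (w - p - A z)| ≤ m * r := by
      refine (abs_real_inner_le_norm _ _).trans ?_
      rw [u.orthonormal.1 i, one_mul]
      exact hz'
    rw [e1]
    refine (abs_add_le _ _).trans ?_
    rw [abs_mul, abs_of_pos (hαpos i)]
    nlinarith [mul_le_mul_of_nonneg_left e2 (hαpos i).le,
      mul_le_mul_of_nonneg_right (hαm i) hr.le]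
  set β := 2 * α κ * r with hβ
  have hβpos : 0 < β := by have := hαpos κ; positivity
  set g : EuclideanSpace ℝ (Fin n) → Fin k → ℤ :=
    fun w i => ⌊inner ℝ (u (Fin.castLE hkn.le i)) (w - p) / β⌋ with hg
  set x : Fin k → ℝ := fun i => α (Fin.castLE hkn.le i) / α κ with hx
  have hx1 : ∀ i, 1 ≤ x i := by
    intro i
    rw [hx, one_le_div (hαpos κ)]
    exact hαa (by rw [hκ, Fin.le_def]; simp)
  set G : Finset (Fin k → ℤ) := Fintype.piFinset fun i => Finset.Icc ⌊-x i⌋ ⌊x i⌋ with hG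
  have hgG : ∀ w ∈ S, g w ∈ G := by
    intro w hw
    rw [hG, Fintype.mem_piFinset]
    intro i
    have := abs_le.mp (hcoord w hw (Fin.castLE hkn.le i))
    have hxβ : x i * β = 2 * α (Fin.castLE hkn.le i) * r := by
      rw [hx, hβ]
      have := (hαpos κ).ne'
      field_simp
    rw [Finset.mem_Icc]
    constructor
    · refine Int.floor_le_floor ?_
      rw [le_div_iff₀ hβpos]
      linarith
    · refine Int.floor_le_floor ?_
      rw [div_le_iff₀ hβpos]
      linarith
  have hGcard : (G.card : ℝ) ≤ ∏ i, 4 * x i := by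
    rw [hG, Fintype.card_piFinset, Nat.cast_prod]
    refine Finset.prod_le_prod (fun i _ => by positivity) fun i _ => ?_
    rw [Int.card_Icc]
    have h1 := Int.floor_le (x i)
    have h2 := Int.lt_floor_add_one (-x i)
    have h3 := Int.floor_le (-x i)
    have h4 : ((⌊x i⌋ + 1 - ⌊-x i⌋).toNat : ℤ) = ⌊x i⌋ + 1 - ⌊-x i⌋ := by
      apply Int.toNat_of_nonneg
      have h5 := Int.lt_floor_add_one (x i)
      have h6 : (0 : ℝ) < ((⌊x i⌋ + 1 - ⌊-x i⌋ : ℤ) : ℝ) := by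
        push_cast
        linarith [hx1 i]
      exact_mod_cast h6.le
    have h5 : ((⌊x i⌋ + 1 - ⌊-x i⌋).toNat : ℝ) = ⌊x i⌋ + 1 - ⌊-x i⌋ := by
      exact_mod_cast congrArg (Int.cast : ℤ → ℝ) h4
    rw [h5]
    linarith [hx1 i]
  have hn0 : (1 : ℝ) ≤ n := by exact_mod_cast (by omega : 1 ≤ n)
  have hdist : ∀ w ∈ S, ∀ w' ∈ S, g w = g w' → dist w w' ≤ 2 * n * β := by
    intro w hw w' hw' hgg
    rw [dist_eq_norm]
    have hc : ∀ i, inner ℝ (u i) (w - w') ^ 2 ≤ (2 * β) ^ 2 := by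
      intro i
      have e1 : inner ℝ (u i) (w - w') = inner ℝ (u i) (w - p) - inner ℝ (u i) (w' - p) := by
        rw [← inner_sub_right]
        congr 1
        abel
      rw [e1]
      refine sq_le_sq' ?_ ?_ <;>
      · by_cases hi : i.val < k
        · have := congrFun hgg ⟨i, hi⟩
          have h1 := Int.abs_sub_lt_one_of_floor_eq_floor this
          rw [← sub_div, abs_div, abs_of_pos hβpos, div_lt_one hβpos] at h1
          have h2 := abs_lt.mp h1
          have h3 : Fin.castLE hkn.le ⟨i, hi⟩ = i := rfl
          rw [h3] at h2
          linarith
        · have h1 := abs_le.mp (hcoord w hw i)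
          have h2 := abs_le.mp (hcoord w' hw' i)
          have h3 : α i ≤ α κ := hαa (by rw [hκ, Fin.le_def]; simpa using hi)
          have h4 : 2 * α i * r ≤ β := by rw [hβ]; gcongr
          linarith
    refine le_of_sq_le_sq ?_ (by positivity)
    rw [← u.sum_sq_norm_inner_right (w - w')]
    calc ∑ i, ‖inner ℝ (u i) (w - w')‖ ^ 2 ≤ ∑ i : Fin n, (2 * β) ^ 2 :=
          Finset.sum_le_sum fun i _ => by simpa using hc i
      _ = n * (2 * β) ^ 2 := by simp
      _ ≤ (2 * n * β) ^ 2 := by nlinarith [mul_nonneg (sub_nonneg.mpr hn0) (sq_nonneg β)]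
  set G' := G.filter fun γ => ∃ w ∈ S, g w = γ with hG'
  have hch : ∀ γ : Fin k → ℤ, ∃ w, γ ∈ G' → w ∈ S ∧ g w = γ := by
    intro γ
    by_cases h : γ ∈ G'
    · obtain ⟨w, hw, hwγ⟩ := (Finset.mem_filter.mp h).2
      exact ⟨w, fun _ => ⟨hw, hwγ⟩⟩
    · exact ⟨0, fun h' => absurd h' h⟩
  choose c hc using hch
  have hDpos : 0 < 2 * n * β := by positivity
  refine ⟨G'.image fun γ => (c γ, 2 * n * β), ?_, ?_, ?_⟩
  · intro q hq
    obtain ⟨γ, hγ, rfl⟩ := Finset.mem_image.mp hq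
    exact ⟨(hc γ hγ).1, hDpos⟩
  · intro w hw
    have hγ : g w ∈ G' := Finset.mem_filter.mpr ⟨hgG w hw, w, hw, rfl⟩
    simp only [Set.mem_iUnion]
    exact ⟨_, Finset.mem_image.mpr ⟨g w, hγ, rfl⟩,
      hdist w hw _ (hc _ hγ).1 (hc _ hγ).2.symm⟩
  · have e1 : ∑ q ∈ G'.image (fun γ => (c γ, 2 * n * β)), q.2 ^ (k + s) ≤
        (∏ i, 4 * x i) * (2 * n * β) ^ (k + s) := by
      rw [Finset.sum_congr rfl (g := fun _ => (2 * n * β) ^ (k + s))]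
      · rw [Finset.sum_const, nsmul_eq_mul]
        gcongr
        refine le_trans ?_ hGcard
        exact_mod_cast Finset.card_image_le.trans (Finset.card_filter_le _ _)
      · intro q hq
        obtain ⟨γ, hγ, rfl⟩ := Finset.mem_image.mp hq
        rfl
    have hακ := hαpos κ
    have e2 : ∏ i, 4 * x i = 4 ^ k * (P / α κ ^ k) := by
      simp [hx, Finset.prod_mul_distrib, Finset.prod_div_distrib, hP]
    have e3 : (2 * n * β) ^ (k + s) = (4 * n) ^ (k + s) * (α κ ^ k * α κ ^ s) * r ^ (k + s) := by
      rw [← Real.rpow_natCast (α κ) k, ← Real.rpow_add hακ, ← Real.mul_rpow (by positivity) hακ.le,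
        ← Real.mul_rpow (by positivity) hr.le, hβ]
      ring_nf
    have e4 : P * α κ ^ s ≤ Real.exp (((1 - s) * a₀ + s * a₁) / 2) := by
      have : P * α κ ^ s = P ^ (1 - s) * (P * α κ) ^ s := by
        rw [Real.mul_rpow hPpos.le hακ.le, ← mul_assoc, ← Real.rpow_add hPpos]
        simp
      rw [this]
      calc P ^ (1 - s) * (P * α κ) ^ s
          ≤ Real.exp (a₀ / 2) ^ (1 - s) * Real.exp (a₁ / 2) ^ s := by
            have h1 : 0 ≤ 1 - s := by linarith [hs.2]
            have h2 := hs.1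
            gcongr
        _ = _ := by
            rw [← Real.exp_mul, ← Real.exp_mul, ← Real.exp_add]
            congr 1
            ring
    have e5 : (4 : ℝ) ^ k * (4 * n) ^ (k + s) ≤ (16 * n) ^ n := by
      have h1 : (4 : ℝ) ^ k ≤ 4 ^ n := pow_le_pow_right₀ (by norm_num) hkn.le
      have h2 : (4 * n : ℝ) ^ (k + s) ≤ (4 * n : ℝ) ^ (n : ℝ) := by
        apply Real.rpow_le_rpow_of_exponent_le (by linarith)
        have : (k + 1 : ℝ) ≤ n := by exact_mod_cast hkn
        linarith [hs.2]
      rw [Real.rpow_natCast] at h2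
      calc (4 : ℝ) ^ k * (4 * n) ^ (k + s) ≤ 4 ^ n * (4 * n) ^ n := by gcongr
        _ = (16 * n) ^ n := by rw [← mul_pow]; ring_nf
    refine e1.trans ?_
    rw [e2, e3]
    calc 4 ^ k * (P / α κ ^ k) * ((4 * n) ^ (k + s) * (α κ ^ k * α κ ^ s) * r ^ (k + s))
        = (4 ^ k * (4 * n) ^ (k + s)) * (P * α κ ^ s) * r ^ (k + s) := by
          field_simp
      _ ≤ _ := by gcongr

theorem Finset.sum_biUnion_le_sum_sum {ι κ : Type*} [DecidableEq ι] [DecidableEq κ]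
    (t : Finset ι) (g : ι → Finset κ) (F : κ → ℝ) (hF : ∀ i ∈ t, ∀ c ∈ g i, 0 ≤ F c) :
    ∑ c ∈ t.biUnion g, F c ≤ ∑ i ∈ t, ∑ c ∈ g i, F c := by
  induction t using Finset.induction_on with
  | empty => simp
  | insert a t ha ih =>
    rw [Finset.biUnion_insert, Finset.sum_insert ha]
    have h1 := Finset.sum_union_inter (s₁ := g a) (s₂ := t.biUnion g) (f := F)
    have h2 : 0 ≤ ∑ c ∈ g a ∩ t.biUnion g, F c := Finset.sum_nonneg fun c hc =>
      hF a (Finset.mem_insert_self _ _) c (Finset.mem_inter.mp hc).1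
    have h3 := ih fun i hi => hF i (Finset.mem_insert_of_mem hi)
    linarith

/-- If a map sends a compact set onto itself and the image of each small ball has covers whose
`d`-dimensional content is at most half that of the ball, then the set has dimension at most
`d`. -/
theorem dimH_le_of_contracting_covers {X : Type*} [MetricSpace X] {K : Set X} (hK : IsCompact K)
    {ψ : X → X} (hψ : K ⊆ ψ '' K) {d : NNReal} (hd : 0 < d) {r₀ : ℝ} (hr₀ : 0 < r₀)
    (hstep : ∀ p ∈ K, ∀ r, 0 < r → r ≤ r₀ → ∃ t : Finset (X × ℝ),
      (∀ c ∈ t, c.1 ∈ K ∧ 0 < c.2) ∧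
      (K ∩ ψ '' (K ∩ Metric.closedBall p r) ⊆ ⋃ c ∈ t, Metric.closedBall c.1 c.2) ∧
      ∑ c ∈ t, c.2 ^ (d : ℝ) ≤ 1 / 2 * r ^ (d : ℝ)) :
    dimH K ≤ d := by
  classical
  have hd' : (0 : ℝ) < d := hd
  obtain ⟨t₀, ht₀K, ht₀f, ht₀⟩ := hK.finite_cover_balls hr₀
  set C : ℝ := ∑ c ∈ ht₀f.toFinset.image (fun x => (x, r₀)), c.2 ^ (d : ℝ) with hC
  have key : ∀ m : ℕ, ∃ t : Finset (X × ℝ), (∀ c ∈ t, c.1 ∈ K ∧ 0 < c.2 ∧ c.2 ≤ r₀) ∧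
      (K ⊆ ⋃ c ∈ t, Metric.closedBall c.1 c.2) ∧
      ∑ c ∈ t, c.2 ^ (d : ℝ) ≤ C * (1 / 2) ^ m := by
    intro m
    induction m with
    | zero =>
      refine ⟨ht₀f.toFinset.image (fun x => (x, r₀)), ?_, ?_, by simp [hC]⟩
      · intro c hc
        obtain ⟨x, hx, rfl⟩ := Finset.mem_image.mp hc
        exact ⟨ht₀K (ht₀f.mem_toFinset.mp hx), hr₀, le_rfl⟩
      · intro x hx
        obtain ⟨y, hy, hxy⟩ := Set.mem_iUnion₂.mp (ht₀ hx)
        exact Set.mem_iUnion₂.mpr ⟨(y, r₀), Finset.mem_image.mpr ⟨y, by simpa using hy, rfl⟩,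
          Metric.ball_subset_closedBall hxy⟩
    | succ m ih =>
      obtain ⟨t, ht1, ht2, ht3⟩ := ih
      have : ∀ c : X × ℝ, ∃ t' : Finset (X × ℝ), c ∈ t →
          (∀ c' ∈ t', c'.1 ∈ K ∧ 0 < c'.2) ∧
          (K ∩ ψ '' (K ∩ Metric.closedBall c.1 c.2) ⊆
            ⋃ c' ∈ t', Metric.closedBall c'.1 c'.2) ∧
          ∑ c' ∈ t', c'.2 ^ (d : ℝ) ≤ 1 / 2 * c.2 ^ (d : ℝ) := by
        intro c
        by_cases hc : c ∈ t
        · obtain ⟨h1, h2, h3⟩ := ht1 c hc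
          obtain ⟨t', ht'⟩ := hstep c.1 h1 c.2 h2 h3
          exact ⟨t', fun _ => ht'⟩
        · exact ⟨∅, fun h => absurd h hc⟩
      choose G hG using this
      have hpos : ∀ c ∈ t, ∀ c' ∈ G c, 0 ≤ c'.2 ^ (d : ℝ) := fun c hc c' hc' =>
        Real.rpow_nonneg ((hG c hc).1 c' hc').2.le _
      refine ⟨t.biUnion G, ?_, ?_, ?_⟩
      · intro c' hc'
        obtain ⟨c, hc, hcc⟩ := Finset.mem_biUnion.mp hc'
        obtain ⟨h1, h2, h3⟩ := hG c hc
        refine ⟨(h1 c' hcc).1, (h1 c' hcc).2, ?_⟩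
        refine le_trans ?_ (ht1 c hc).2.2
        have hcpos := (ht1 c hc).2.1
        have h4 : c'.2 ^ (d : ℝ) ≤ c.2 ^ (d : ℝ) := by
          have h5 := Finset.single_le_sum (f := fun c' : X × ℝ => c'.2 ^ (d : ℝ))
            (hpos c hc) hcc
          have h6 := Real.rpow_nonneg hcpos.le (d : ℝ)
          linarith
        exact (Real.rpow_le_rpow_iff (h1 c' hcc).2.le hcpos.le hd').mp h4
      · intro y hy
        obtain ⟨x, hx, rfl⟩ := hψ hy
        obtain ⟨c, hc, hxc⟩ := Set.mem_iUnion₂.mp (ht2 hx)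
        obtain ⟨c', hc', hyc⟩ := Set.mem_iUnion₂.mp ((hG c hc).2.1 ⟨hy, x, ⟨hx, hxc⟩, rfl⟩)
        exact Set.mem_iUnion₂.mpr ⟨c', Finset.mem_biUnion.mpr ⟨c, hc, hc'⟩, hyc⟩
      · calc ∑ c' ∈ t.biUnion G, c'.2 ^ (d : ℝ)
            ≤ ∑ c ∈ t, ∑ c' ∈ G c, c'.2 ^ (d : ℝ) := Finset.sum_biUnion_le_sum_sum _ _ _ hpos
          _ ≤ ∑ c ∈ t, 1 / 2 * c.2 ^ (d : ℝ) := Finset.sum_le_sum fun c hc => (hG c hc).2.2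
          _ = 1 / 2 * ∑ c ∈ t, c.2 ^ (d : ℝ) := by rw [Finset.mul_sum]
          _ ≤ 1 / 2 * (C * (1 / 2) ^ m) := by gcongr
          _ = C * (1 / 2) ^ (m + 1) := by ring
  choose t ht1 ht2 ht3 using key
  have hC0 : 0 ≤ C := Finset.sum_nonneg fun c hc => by
    obtain ⟨x, hx, rfl⟩ := Finset.mem_image.mp hc
    positivity
  borelize X
  refine dimH_le_of_hausdorffMeasure_ne_top ?_
  have hgeom : Tendsto (fun m : ℕ => C * (1 / 2 : ℝ) ^ m) atTop (𝓝 0) := by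
    simpa using (tendsto_pow_atTop_nhds_zero_of_lt_one (by norm_num : (0 : ℝ) ≤ 1 / 2)
      (by norm_num)).const_mul C
  have hrad : Tendsto (fun m : ℕ => ENNReal.ofReal (2 * (C * (1 / 2 : ℝ) ^ m) ^ (d : ℝ)⁻¹)) atTop
      (𝓝 0) := by
    have h1 := (hgeom.rpow_const (p := (d : ℝ)⁻¹) (Or.inr (by positivity))).const_mul 2
    rw [Real.zero_rpow (by positivity), mul_zero] at h1
    simpa using ENNReal.tendsto_ofReal h1
  have hdiam : ∀ (m : ℕ) (i : t m),
      Metric.ediam (Metric.closedBall i.1.1 i.1.2) ≤ ENNReal.ofReal (2 * i.1.2) := by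
    intro m i
    rw [ENNReal.ofReal_mul (by norm_num), ENNReal.ofReal_ofNat, ← Metric.closedEBall_ofReal
      (ht1 m i.1 i.2).2.1.le]
    exact Metric.ediam_closedEBall_le
  have hle := MeasureTheory.Measure.hausdorffMeasure_le_liminf_sum (d : ℝ) K (l := atTop)
    _ hrad (fun m (i : t m) => Metric.closedBall i.1.1 i.1.2)
    (Eventually.of_forall fun m i => by
      refine (hdiam m i).trans (ENNReal.ofReal_le_ofReal ?_)
      have hpos := (ht1 m i.1 i.2).2.1
      gcongr
      rw [Real.le_rpow_inv_iff_of_pos hpos.le (by positivity) hd']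
      refine le_trans ?_ (ht3 m)
      exact Finset.single_le_sum (f := fun c' : X × ℝ => c'.2 ^ (d : ℝ))
        (fun c hc => Real.rpow_nonneg (ht1 m c hc).2.1.le _) i.2)
    (Eventually.of_forall fun m x hx => by
      obtain ⟨c, hc, hxc⟩ := Set.mem_iUnion₂.mp (ht2 m hx)
      exact Set.mem_iUnion.mpr ⟨⟨c, hc⟩, hxc⟩)
  refine ne_top_of_le_ne_top ?_ (hle.trans (Filter.liminf_le_of_le (by isBoundedDefault)
    (a := ENNReal.ofReal (2 ^ (d : ℝ) * C)) ?_))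
  · exact ENNReal.ofReal_ne_top
  · intro b hb
    obtain ⟨m, hm⟩ := hb.exists
    refine hm.trans ?_
    calc ∑ i : t m, Metric.ediam (Metric.closedBall i.1.1 i.1.2) ^ (d : ℝ)
        ≤ ∑ i : t m, ENNReal.ofReal (2 ^ (d : ℝ) * i.1.2 ^ (d : ℝ)) := by
          refine Finset.sum_le_sum fun i _ => ?_
          have hpos := (ht1 m i.1 i.2).2.1
          rw [← Real.mul_rpow (by norm_num) hpos.le, ← ENNReal.ofReal_rpow_of_pos (by positivity)]
          exact ENNReal.rpow_le_rpow (hdiam m i) hd'.le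
      _ = ENNReal.ofReal (∑ i : t m, 2 ^ (d : ℝ) * i.1.2 ^ (d : ℝ)) := by
          rw [ENNReal.ofReal_sum_of_nonneg]
          intro i _
          have hpos := (ht1 m i.1 i.2).2.1
          positivity
      _ ≤ ENNReal.ofReal (2 ^ (d : ℝ) * C) := by
          apply ENNReal.ofReal_le_ofReal
          rw [← Finset.mul_sum, Finset.sum_coe_sort (t m) (fun c => c.2 ^ (d : ℝ))]
          gcongr
          refine (ht3 m).trans (mul_le_of_le_one_right hC0 ?_)
          exact pow_le_one₀ (by norm_num) (by norm_num)

theorem exists_uniform_nhds_of_continuousOn {X Y : Type*} [MetricSpace X] [PseudoMetricSpace Y]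
    {U K : Set X} (hU : IsOpen U) (hK : IsCompact K) (hKU : K ⊆ U) {g : X → Y}
    (hg : ContinuousOn g U) {ε : ℝ} (hε : 0 < ε) :
    ∃ δ > 0, ∀ x ∈ K, ∀ y, dist y x < δ → y ∈ U ∧ dist (g y) (g x) < ε := by
  obtain ⟨δ₁, hδ₁, h₁⟩ := hK.exists_thickening_subset_open hU hKU
  have h := hK.uniformContinuousAt_of_continuousAt g
    (fun x hx => hg.continuousAt (hU.mem_nhds (hKU hx))) (Metric.dist_mem_uniformity hε)
  obtain ⟨δ₂, hδ₂, h₂⟩ := Metric.mem_uniformity_dist.mp h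
  refine ⟨min δ₁ δ₂, lt_min hδ₁ hδ₂, fun x hx y hxy => ⟨?_, ?_⟩⟩
  · exact h₁ (Metric.mem_thickening_iff.mpr ⟨x, hx, hxy.trans_le (min_le_left _ _)⟩)
  · have := h₂ (a := x) (b := y) (by rw [dist_comm]; exact hxy.trans_le (min_le_right _ _)) hx
    rw [dist_comm]
    exact this

/-- Trajectories staying in a set where `f` is bounded by `F` have speed at most `F`. -/
theorem norm_flow_sub_le {E : Type*} [NormedAddCommGroup E] [NormedSpace ℝ E] {f : E → E}
    {K : Set E} {φ : ℝ → E → E} (hφ0 : ∀ x ∈ K, φ 0 x = x) (hφK : ∀ x ∈ K, ∀ t : ℝ, φ t x ∈ K)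
    (hφd : ∀ x ∈ K, ∀ t : ℝ, HasDerivAt (fun s => φ s x) (f (φ t x)) t) {F : ℝ}
    (hF : ∀ x ∈ K, ‖f x‖ ≤ F) {x : E} (hx : x ∈ K) {t : ℝ} (ht : 0 ≤ t) :
    ‖φ t x - x‖ ≤ F * t := by
  have := norm_image_sub_le_of_norm_deriv_le_segment' (a := 0) (b := t)
    (fun r _ => (hφd x hx r).hasDerivWithinAt) (fun r _ => hF _ (hφK x hx r)) t ⟨ht, le_rfl⟩
  simpa [hφ0 x hx] using this

theorem exists_short_time_lyapunov {E : Type*} [NormedAddCommGroup E] [NormedSpace ℝ E]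
    {U K : Set E} (hU : IsOpen U) (hK : IsCompact K) (hKU : K ⊆ U) {f : E → E}
    (hf : ContinuousOn f U) {φ : ℝ → E → E} (hφ0 : ∀ x ∈ K, φ 0 x = x)
    (hφK : ∀ x ∈ K, ∀ t : ℝ, φ t x ∈ K)
    (hφd : ∀ x ∈ K, ∀ t : ℝ, HasDerivAt (fun s => φ s x) (f (φ t x)) t)
    {v : E → ℝ} (hv : ContDiffOn ℝ 1 v U) {ε : ℝ} (hε : 0 < ε) :
    ∃ h₀ > 0, ∀ h, 0 ≤ h → h ≤ h₀ → ∀ x ∈ K,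
      |v (φ h x) - v x - h * fderiv ℝ v x (f x)| ≤ ε * h := by
  have hw : ContinuousOn (fun x => fderiv ℝ v x (f x)) U :=
    (hv.continuousOn_fderiv_of_isOpen hU le_rfl).clm_apply hf
  obtain ⟨δ, hδ, hδ'⟩ := exists_uniform_nhds_of_continuousOn hU hK hKU hw hε
  obtain ⟨F, hF⟩ := hK.exists_bound_of_continuousOn (hf.mono hKU)
  have hF' : ∀ x ∈ K, ‖f x‖ ≤ |F| + 1 := fun x hx => by
    linarith [hF x hx, le_abs_self F]
  have hFpos : 0 < |F| + 1 := by positivity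
  refine ⟨δ / (2 * (|F| + 1)), by positivity, fun h hh hh0 x hx => ?_⟩
  have hd : ∀ t, HasDerivAt (fun s => v (φ s x) - s * fderiv ℝ v x (f x))
      (fderiv ℝ v (φ t x) (f (φ t x)) - 1 * fderiv ℝ v x (f x)) t := by
    intro t
    have hmem := hKU (hφK x hx t)
    have h1 : HasFDerivAt v (fderiv ℝ v (φ t x)) (φ t x) :=
      ((hv.differentiableOn one_ne_zero).differentiableAt (hU.mem_nhds hmem)).hasFDerivAt
    exact (h1.comp_hasDerivAt t (hφd x hx t)).sub ((hasDerivAt_id t).mul_const _)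
  have := norm_image_sub_le_of_norm_deriv_le_segment' (a := 0) (b := h) (C := ε)
    (fun r _ => (hd r).hasDerivWithinAt) (fun r hr => ?_) h ⟨hh, le_rfl⟩
  · rw [Real.norm_eq_abs, hφ0 x hx] at this
    convert this using 2
    · ring
    · ring
  · rw [one_mul, ← dist_eq_norm]
    refine (hδ' x hx _ ?_).2.le
    rw [dist_eq_norm]
    refine (norm_flow_sub_le hφ0 hφK hφd hF' hx hr.1).trans_lt ?_
    have h1 : r ≤ δ / (2 * (|F| + 1)) := hr.2.le.trans hh0
    rw [le_div_iff₀ (by positivity)] at h1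
    nlinarith

/-- For short times the flow is, uniformly on a compact invariant set, close to its
linearization. -/
theorem exists_short_time_linearization {E : Type*} [NormedAddCommGroup E] [NormedSpace ℝ E]
    {U K : Set E} (hU : IsOpen U) (hK : IsCompact K) (hKU : K ⊆ U) {f : E → E}
    (hf : ContDiffOn ℝ 1 f U) {φ : ℝ → E → E} (hφ0 : ∀ x ∈ K, φ 0 x = x)
    (hφK : ∀ x ∈ K, ∀ t : ℝ, φ t x ∈ K)
    (hφd : ∀ x ∈ K, ∀ t : ℝ, HasDerivAt (fun s => φ s x) (f (φ t x)) t)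
    {ε : ℝ} (hε : 0 < ε) :
    ∃ h₀ > 0, ∃ ρ > 0, ∀ h, 0 ≤ h → h ≤ h₀ → ∀ x ∈ K, ∀ y ∈ K, ‖y - x‖ ≤ ρ →
      ‖φ h y - φ h x - (y - x + h • fderiv ℝ f x (y - x))‖ ≤ ε * h * ‖y - x‖ := by
  have hJ : ContinuousOn (fderiv ℝ f) U := hf.continuousOn_fderiv_of_isOpen hU le_rfl
  obtain ⟨F, hF⟩ := hK.exists_bound_of_continuousOn (hf.continuousOn.mono hKU)
  have hF' : ∀ x ∈ K, ‖f x‖ ≤ |F| + 1 := fun x hx => by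
    linarith [hF x hx, le_abs_self F]
  obtain ⟨M, hM⟩ := hK.exists_bound_of_continuousOn (hJ.mono hKU)
  have hM' : ∀ x ∈ K, ‖fderiv ℝ f x‖ ≤ |M| := fun x hx => (hM x hx).trans (le_abs_self M)
  set ε' := min 1 (ε / 4) with hε'
  have hε'pos : 0 < ε' := by positivity
  obtain ⟨δ, hδ, hδ'⟩ := exists_uniform_nhds_of_continuousOn hU hK hKU hJ hε'pos
  set L := |M| + 1 with hL
  have hLpos : 0 < L := by positivity
  refine ⟨min (δ / (4 * (|F| + 1))) (min (1 / (2 * L)) (ε / (4 * L * L))), by positivity,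
    δ / 4, by positivity, fun h hh hh0 x hx y hy hxy => ?_⟩
  have hh1 : h * (4 * (|F| + 1)) ≤ δ := by
    rw [← le_div_iff₀ (by positivity)]
    exact hh0.trans (min_le_left _ _)
  have hh2 : h * (2 * L) ≤ 1 := by
    rw [← le_div_iff₀ (by positivity)]
    exact hh0.trans ((min_le_right _ _).trans (min_le_left _ _))
  have hh3 : h * (4 * L * L) ≤ ε := by
    rw [← le_div_iff₀ (by positivity)]
    exact hh0.trans ((min_le_right _ _).trans (min_le_right _ _))
  have hmem : ∀ t ∈ Set.Icc 0 h, φ t x ∈ Metric.ball x δ ∧ φ t y ∈ Metric.ball x δ := by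
    intro t ht
    have h1 := norm_flow_sub_le hφ0 hφK hφd hF' hx ht.1
    have h2 := norm_flow_sub_le hφ0 hφK hφd hF' hy ht.1
    have h3 : (|F| + 1) * t ≤ δ / 4 := by nlinarith [ht.2, abs_nonneg F]
    rw [Metric.mem_ball, Metric.mem_ball, dist_eq_norm, dist_eq_norm]
    refine ⟨by linarith, ?_⟩
    have h4 : φ t y - x = (φ t y - y) + (y - x) := by abel
    rw [h4]
    refine (norm_add_le _ _).trans_lt ?_
    linarith
  have hlin : ∀ t ∈ Set.Icc 0 h, ‖f (φ t y) - f (φ t x) - fderiv ℝ f x (φ t y - φ t x)‖ ≤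
      ε' * ‖φ t y - φ t x‖ := by
    intro t ht
    refine Convex.norm_image_sub_le_of_norm_fderiv_le' (s := Metric.ball x δ) (𝕜 := ℝ) ?_ ?_
      (convex_ball x δ) (hmem t ht).1 (hmem t ht).2
    · intro z hz
      exact (hf.differentiableOn one_ne_zero).differentiableAt
        (hU.mem_nhds (hδ' x hx z hz).1)
    · intro z hz
      rw [← dist_eq_norm]
      exact (hδ' x hx z hz).2.le
  have hlip : ∀ t ∈ Set.Icc 0 h, ‖f (φ t y) - f (φ t x)‖ ≤ L * ‖φ t y - φ t x‖ := by
    intro t ht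
    have h1 : ‖fderiv ℝ f x (φ t y - φ t x)‖ ≤ |M| * ‖φ t y - φ t x‖ :=
      (ContinuousLinearMap.le_opNorm _ _).trans
        (mul_le_mul_of_nonneg_right (hM' x hx) (norm_nonneg _))
    have h2 := norm_sub_norm_le (f (φ t y) - f (φ t x)) (fderiv ℝ f x (φ t y - φ t x))
    have h3 : ε' * ‖φ t y - φ t x‖ ≤ 1 * ‖φ t y - φ t x‖ :=
      mul_le_mul_of_nonneg_right (min_le_left _ _) (norm_nonneg _)
    linarith [hlin t ht]
  have hDd : ∀ t, HasDerivAt (fun t => φ t y - φ t x) (f (φ t y) - f (φ t x)) t :=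
    fun t => (hφd y hy t).sub (hφd x hx t)
  have hD0 : φ 0 y - φ 0 x = y - x := by rw [hφ0 x hx, hφ0 y hy]
  have hD : ∀ t ∈ Set.Icc 0 h, ‖φ t y - φ t x‖ ≤ 2 * ‖y - x‖ := by
    intro t ht
    have h1 := norm_le_gronwallBound_of_norm_deriv_right_le (a := 0) (b := h)
      (f := fun t => φ t y - φ t x) (f' := fun t => f (φ t y) - f (φ t x))
      (δ := ‖y - x‖) (K := L) (ε := 0)
      (fun t _ => (hDd t).continuousAt.continuousWithinAt)
      (fun t _ => (hDd t).hasDerivWithinAt) (by rw [hD0])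
      (fun t ht => by simpa using hlip t ⟨ht.1, ht.2.le⟩) t ht
    rw [gronwallBound_ε0, sub_zero] at h1
    have h2 : Real.exp (L * t) ≤ 2 := by
      have h3 : L * t ≤ 1 / 2 := by nlinarith [ht.2]
      have h4 := Real.exp_bound_div_one_sub_of_interval (x := 1 / 2) (by norm_num) (by norm_num)
      refine (Real.exp_le_exp.mpr h3).trans (h4.trans ?_)
      norm_num
    refine h1.trans ?_
    rw [mul_comm]
    exact mul_le_mul_of_nonneg_right h2 (norm_nonneg _)
  have hDD : ∀ t ∈ Set.Icc 0 h, ‖φ t y - φ t x - (y - x)‖ ≤ 2 * L * ‖y - x‖ * h := by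
    intro t ht
    have h1 := norm_image_sub_le_of_norm_deriv_le_segment' (a := 0) (b := h)
      (f := fun t => φ t y - φ t x) (C := 2 * L * ‖y - x‖)
      (fun r _ => (hDd r).hasDerivWithinAt)
      (fun r hr => by
        have hr' : r ∈ Set.Icc 0 h := ⟨hr.1, hr.2.le⟩
        refine (hlip r hr').trans ?_
        nlinarith [hD r hr']) t ht
    rw [hD0] at h1
    refine h1.trans ?_
    rw [sub_zero]
    have := ht.2
    gcongr
  have hz := norm_image_sub_le_of_norm_deriv_le_segment' (a := 0) (b := h)
    (f := fun t => φ t y - φ t x - t • fderiv ℝ f x (y - x)) (C := ε * ‖y - x‖)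
    (fun r _ => ((hDd r).sub ((hasDerivAt_id r).smul_const _)).hasDerivWithinAt)
    (fun r hr => ?_) h ⟨hh, le_rfl⟩
  · simp only [hD0, zero_smul, sub_zero] at hz
    have e0 : φ h y - φ h x - (y - x + h • fderiv ℝ f x (y - x)) =
        φ h y - φ h x - h • fderiv ℝ f x (y - x) - (y - x) := by abel
    rw [e0]
    linarith
  · have hr' : r ∈ Set.Icc 0 h := ⟨hr.1, hr.2.le⟩
    have e1 : f (φ r y) - f (φ r x) - (1 : ℝ) • fderiv ℝ f x (y - x) =
        (f (φ r y) - f (φ r x) - fderiv ℝ f x (φ r y - φ r x)) +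
          fderiv ℝ f x (φ r y - φ r x - (y - x)) := by
      rw [map_sub (fderiv ℝ f x) (φ r y - φ r x), one_smul]
      abel
    rw [e1]
    refine (norm_add_le _ _).trans ?_
    have e2 : ‖fderiv ℝ f x (φ r y - φ r x - (y - x))‖ ≤ L * (2 * L * ‖y - x‖ * h) := by
      refine (ContinuousLinearMap.le_opNorm _ _).trans ?_
      have := hM' x hx
      exact mul_le_mul (by linarith) (hDD r hr') (norm_nonneg _) hLpos.le
    have e3 : ε' * ‖φ r y - φ r x‖ ≤ ε / 4 * (2 * ‖y - x‖) :=
      mul_le_mul (min_le_right _ _) (hD r hr') (norm_nonneg _) (by positivity)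
    have e4 : L * (2 * L * ‖y - x‖ * h) ≤ ε / 2 * ‖y - x‖ := by
      nlinarith [mul_le_mul_of_nonneg_right hh3 (norm_nonneg (y - x))]
    exact (add_le_add ((hlin r hr').trans e3) e2).trans (by linarith)

/-- Iterating a map that is close to linear maps on small scales gives a map that is close to the
composed linear maps, with the corresponding bounds on volumes. -/
theorem exists_iterate_linearization {n k : ℕ} {s : ℝ} {K : Set (EuclideanSpace ℝ (Fin n))}
    {ψ : EuclideanSpace ℝ (Fin n) → EuclideanSpace ℝ (Fin n)} (hψ : ∀ x ∈ K, ψ x ∈ K)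
    {B : EuclideanSpace ℝ (Fin n) → EuclideanSpace ℝ (Fin n) →L[ℝ] EuclideanSpace ℝ (Fin n)}
    {b₀ b₁ v : EuclideanSpace ℝ (Fin n) → ℝ} {q c η D ρ : ℝ} (hq : 1 ≤ q) (hc : 0 ≤ c)
    (hη : 0 ≤ η) (hBq : ∀ x ∈ K, ‖B x‖ ≤ q) (hBc : ∀ x ∈ K, ∀ z, ‖z‖ ≤ c * ‖B x z‖)
    (h₀ : ∀ x ∈ K, GramBound k (B x) (b₀ x)) (h₁ : ∀ x ∈ K, GramBound (k + 1) (B x) (b₁ x))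
    (hb : ∀ x ∈ K, (1 - s) * b₀ x + s * b₁ x ≤ -D - (v (ψ x) - v x))
    (hlip : ∀ x ∈ K, ∀ y ∈ K, ‖y - x‖ ≤ ρ → ‖ψ y - ψ x‖ ≤ q * ‖y - x‖)
    (hlin : ∀ x ∈ K, ∀ y ∈ K, ‖y - x‖ ≤ ρ → ‖ψ y - ψ x - B x (y - x)‖ ≤ η * ‖y - x‖)
    (j : ℕ) {x : EuclideanSpace ℝ (Fin n)} (hx : x ∈ K) :
    ∃ (A : EuclideanSpace ℝ (Fin n) →L[ℝ] EuclideanSpace ℝ (Fin n)) (a₀ a₁ : ℝ),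
      (∀ z, ‖z‖ ≤ c ^ j * ‖A z‖) ∧ GramBound k A a₀ ∧ GramBound (k + 1) A a₁ ∧
      (1 - s) * a₀ + s * a₁ ≤ -(j * D) - (v (ψ^[j] x) - v x) ∧
      ∀ y ∈ K, q ^ j * ‖y - x‖ ≤ ρ → ‖ψ^[j] y - ψ^[j] x‖ ≤ q ^ j * ‖y - x‖ ∧
        ‖ψ^[j] y - ψ^[j] x - A (y - x)‖ ≤ j * η * q ^ j * ‖y - x‖ := by
  induction j with
  | zero =>
    exact ⟨ContinuousLinearMap.id ℝ _, 0, 0, by simp, GramBound.id, GramBound.id, by simp,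
      by simp⟩
  | succ j ih =>
    obtain ⟨A, a₀, a₁, hA, hA₀, hA₁, ha, hAy⟩ := ih
    have hit : ∀ x ∈ K, ψ^[j] x ∈ K := fun x hx => Set.MapsTo.iterate (f := ψ) hψ j hx
    have hxj := hit x hx
    refine ⟨(B (ψ^[j] x)).comp A, b₀ (ψ^[j] x) + a₀, b₁ (ψ^[j] x) + a₁, ?_,
      (h₀ _ hxj).comp hA₀, (h₁ _ hxj).comp hA₁, ?_, ?_⟩
    · intro z
      refine (hA z).trans ?_
      rw [pow_succ, mul_assoc]
      exact mul_le_mul_of_nonneg_left (hBc _ hxj _) (pow_nonneg hc j)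
    · rw [Function.iterate_succ_apply']
      have := hb _ hxj
      push_cast
      linarith
    · intro y hy hyx
      have hq0 : 0 < q := by linarith
      have hstep : q ^ j * ‖y - x‖ ≤ q ^ (j + 1) * ‖y - x‖ :=
        mul_le_mul_of_nonneg_right (pow_le_pow_right₀ hq j.le_succ) (norm_nonneg _)
      obtain ⟨h1, h2⟩ := hAy y hy (hstep.trans hyx)
      have hsmall := h1.trans (hstep.trans hyx)
      rw [Function.iterate_succ_apply', Function.iterate_succ_apply']
      refine ⟨?_, ?_⟩
      · refine (hlip _ hxj _ (hit y hy) hsmall).trans ?_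
        rw [pow_succ' q, mul_assoc]
        exact mul_le_mul_of_nonneg_left h1 hq0.le
      · have e : ψ (ψ^[j] y) - ψ (ψ^[j] x) - ((B (ψ^[j] x)).comp A) (y - x) =
            (ψ (ψ^[j] y) - ψ (ψ^[j] x) - B (ψ^[j] x) (ψ^[j] y - ψ^[j] x)) +
              B (ψ^[j] x) (ψ^[j] y - ψ^[j] x - A (y - x)) := by
          rw [map_sub (B (ψ^[j] x)) (ψ^[j] y - ψ^[j] x), ContinuousLinearMap.comp_apply]
          abel
        rw [e]
        refine (norm_add_le _ _).trans ?_
        have h3 := hlin _ hxj _ (hit y hy) hsmall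
        have h4 : ‖B (ψ^[j] x) (ψ^[j] y - ψ^[j] x - A (y - x))‖ ≤
            q * (j * η * q ^ j * ‖y - x‖) :=
          (ContinuousLinearMap.le_opNorm _ _).trans
            (mul_le_mul (hBq _ hxj) h2 (norm_nonneg _) hq0.le)
        have h5 : η * ‖ψ^[j] y - ψ^[j] x‖ ≤ η * (q ^ (j + 1) * ‖y - x‖) :=
          mul_le_mul_of_nonneg_left (h1.trans hstep) hη
        rw [pow_succ] at h5 ⊢
        push_cast
        linarith

/-- For each time `T`, some map sending a compact invariant set `K` onto itself is, near each
point of `K`, close to a linear map whose volume growth is bounded in terms of `T`. -/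
theorem exists_long_time_linearization {n k : ℕ} (hkn : k < n) {s : ℝ}
    (hs : s ∈ Set.Icc (0 : ℝ) 1)
    {U K : Set (EuclideanSpace ℝ (Fin n))} (hU : IsOpen U) (hK : IsCompact K) (hKU : K ⊆ U)
    {f : EuclideanSpace ℝ (Fin n) → EuclideanSpace ℝ (Fin n)} (hf : ContDiffOn ℝ 1 f U)
    {φ : ℝ → EuclideanSpace ℝ (Fin n) → EuclideanSpace ℝ (Fin n)} (hφ0 : ∀ x ∈ K, φ 0 x = x)
    (hφK : ∀ x ∈ K, ∀ t : ℝ, φ t x ∈ K)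
    (hφd : ∀ x ∈ K, ∀ t : ℝ, HasDerivAt (fun s => φ s x) (f (φ t x)) t)
    (hφonto : ∀ t : ℝ, φ t '' K = K)
    {v : EuclideanSpace ℝ (Fin n) → ℝ} (hv : ContDiffOn ℝ 1 v U)
    {L₀ L₁ : EuclideanSpace ℝ (Fin n) → ℝ}
    (hL₀ : ∀ x ∈ K, ∀ q : Fin k → EuclideanSpace ℝ (Fin n), Orthonormal ℝ q →
      ∑ a, 2 * inner ℝ (q a) (fderiv ℝ f x (q a)) ≤ L₀ x)
    (hL₁ : ∀ x ∈ K, ∀ q : Fin (k + 1) → EuclideanSpace ℝ (Fin n), Orthonormal ℝ q →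
      ∑ a, 2 * inner ℝ (q a) (fderiv ℝ f x (q a)) ≤ L₁ x)
    {δ : ℝ} (hδ : 0 < δ)
    (hcond : ∀ x ∈ K, (1 - s) * L₀ x + s * L₁ x + fderiv ℝ v x (f x) ≤ -δ) {T : ℝ} (hT0 : 0 < T) :
    ∃ ψ : EuclideanSpace ℝ (Fin n) → EuclideanSpace ℝ (Fin n), (∀ x ∈ K, ψ x ∈ K) ∧
      K ⊆ ψ '' K ∧ ∃ r₀ > 0, ∃ m > 0, ∀ p ∈ K,
      ∃ (A : EuclideanSpace ℝ (Fin n) →L[ℝ] EuclideanSpace ℝ (Fin n)) (a₀ a₁ : ℝ),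
        (∀ w, m * ‖w‖ ≤ ‖A w‖) ∧ GramBound k A a₀ ∧ GramBound (k + 1) A a₁ ∧
        (1 - s) * a₀ + s * a₁ ≤ -(T * (δ / 2)) - (v (ψ p) - v p) ∧
        ∀ y ∈ K, ‖y - p‖ ≤ r₀ → ‖ψ y - ψ p - A (y - p)‖ ≤ m * ‖y - p‖ := by
  have hn : (0 : ℝ) < n := by exact_mod_cast (Nat.zero_le k).trans_lt hkn
  obtain ⟨M', hM'⟩ :=
    hK.exists_bound_of_continuousOn ((hf.continuousOn_fderiv_of_isOpen hU le_rfl).mono hKU)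
  set M := |M'| with hMdef
  have hM0 : 0 ≤ M := abs_nonneg _
  have hM : ∀ x ∈ K, ‖fderiv ℝ f x‖ ≤ M := fun x hx => (hM' x hx).trans (le_abs_self _)
  set L := M + 1 with hL
  have hLpos : 0 < L := by positivity
  set ε := min 1 (min (δ / 4) (Real.exp (-(3 * L * T)) / T)) with hε
  have hε0 : 0 < ε := by positivity
  have hε1 : ε ≤ 1 := min_le_left _ _
  have hε2 : ε ≤ δ / 4 := (min_le_right _ _).trans (min_le_left _ _)
  have hε3 : T * ε ≤ Real.exp (-(3 * L * T)) := by
    have : ε ≤ Real.exp (-(3 * L * T)) / T := (min_le_right _ _).trans (min_le_right _ _)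
    rw [le_div_iff₀ hT0] at this
    linarith
  obtain ⟨h₁, h₁pos, hlyap⟩ :=
    exists_short_time_lyapunov hU hK hKU hf.continuousOn hφ0 hφK hφd hv hε0
  obtain ⟨h₂, h₂pos, ρ, hρ, hlin⟩ :=
    exists_short_time_linearization hU hK hKU hf hφ0 hφK hφd hε0
  set h₃ := min (min h₁ h₂) (min (1 / (2 * L)) (δ / (4 * (n * (M ^ 2 + 1))))) with hh₃
  have h₃pos : 0 < h₃ := by positivity
  obtain ⟨N, hN⟩ := exists_nat_gt (T / h₃)
  have hN0 : (0 : ℝ) < N := lt_of_le_of_lt (by positivity) hN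
  set h := T / N with hh
  have hpos : 0 < h := by positivity
  have hNh : N * h = T := by rw [hh]; field_simp
  have hle : h ≤ h₃ := by
    rw [div_lt_iff₀ h₃pos] at hN
    rw [hh, div_le_iff₀ hN0]
    linarith
  have hle₁ : h ≤ h₁ := hle.trans ((min_le_left _ _).trans (min_le_left _ _))
  have hle₂ : h ≤ h₂ := hle.trans ((min_le_left _ _).trans (min_le_right _ _))
  have hle₃ : h * L ≤ 1 / 2 := by
    have : h ≤ 1 / (2 * L) := hle.trans ((min_le_right _ _).trans (min_le_left _ _))
    rw [le_div_iff₀ (by positivity)] at this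
    linarith
  have hle₄ : h * (n * M ^ 2) ≤ δ / 4 := by
    have : h ≤ δ / (4 * (n * (M ^ 2 + 1))) :=
      hle.trans ((min_le_right _ _).trans (min_le_right _ _))
    rw [le_div_iff₀ (by positivity)] at this
    nlinarith [mul_pos hpos hn]
  set B : EuclideanSpace ℝ (Fin n) → EuclideanSpace ℝ (Fin n) →L[ℝ] EuclideanSpace ℝ (Fin n) :=
    fun x => ContinuousLinearMap.id ℝ _ + h • fderiv ℝ f x with hB
  have hJz : ∀ x ∈ K, ∀ z, ‖h • fderiv ℝ f x z‖ ≤ h * M * ‖z‖ := by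
    intro x hx z
    rw [norm_smul, Real.norm_of_nonneg hpos.le, mul_assoc]
    exact mul_le_mul_of_nonneg_left ((ContinuousLinearMap.le_opNorm _ _).trans
      (mul_le_mul_of_nonneg_right (hM x hx) (norm_nonneg _))) hpos.le
  have hBle : ∀ x ∈ K, ∀ z, ‖B x z‖ ≤ (1 + h * M) * ‖z‖ := by
    intro x hx z
    have h1 : B x z = z + h • fderiv ℝ f x z := rfl
    rw [h1]
    refine (norm_add_le _ _).trans ?_
    linarith [hJz x hx z]
  have hhM : h * M ≤ h * L := by rw [hL]; nlinarith
  have hBq : ∀ x ∈ K, ‖B x‖ ≤ 1 + h * L := fun x hx =>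
    ContinuousLinearMap.opNorm_le_bound _ (by positivity) fun z =>
      (hBle x hx z).trans (mul_le_mul_of_nonneg_right (by linarith) (norm_nonneg _))
  have hBc : ∀ x ∈ K, ∀ z, ‖z‖ ≤ (1 + 2 * (h * L)) * ‖B x z‖ := by
    intro x hx z
    have h1 : B x z = z + h • fderiv ℝ f x z := rfl
    have h2 : (1 - h * L) * ‖z‖ ≤ ‖B x z‖ := by
      rw [h1]
      have h3 := norm_sub_le (z + h • fderiv ℝ f x z) (h • fderiv ℝ f x z)
      rw [add_sub_cancel_right] at h3
      nlinarith [hJz x hx z, norm_nonneg z]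
    have h4 : (1 + 2 * (h * L)) * ((1 - h * L) * ‖z‖) ≤ (1 + 2 * (h * L)) * ‖B x z‖ :=
      mul_le_mul_of_nonneg_left h2 (by positivity)
    have h5 : 0 ≤ h * L * (1 - 2 * (h * L)) * ‖z‖ := by
      have : 0 ≤ 1 - 2 * (h * L) := by linarith
      positivity
    nlinarith
  have hG₀ : ∀ x ∈ K, GramBound k (B x) (h * L₀ x + h ^ 2 * k * M ^ 2) := fun x hx =>
    gramBound_id_add_smul hpos.le (hM x hx) (hL₀ x hx)
  have hG₁ : ∀ x ∈ K, GramBound (k + 1) (B x) (h * L₁ x + h ^ 2 * (k + 1 : ℕ) * M ^ 2) :=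
    fun x hx => gramBound_id_add_smul hpos.le (hM x hx) (hL₁ x hx)
  have hkn' : ((k + 1 : ℕ) : ℝ) ≤ n := by exact_mod_cast hkn
  have hb : ∀ x ∈ K, (1 - s) * (h * L₀ x + h ^ 2 * k * M ^ 2) +
      s * (h * L₁ x + h ^ 2 * (k + 1 : ℕ) * M ^ 2) ≤ -(h * (δ / 2)) - (v (φ h x) - v x) := by
    intro x hx
    have h1 := (abs_le.mp (hlyap h hpos.le hle₁ x hx)).2
    have h2 := mul_le_mul_of_nonneg_left (hcond x hx) hpos.le
    have h3 : h * (h * (n * M ^ 2)) ≤ h * (δ / 4) := mul_le_mul_of_nonneg_left hle₄ hpos.le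
    have h4 : ((1 - s) * k + s * (k + 1 : ℕ)) * (h ^ 2 * M ^ 2) ≤ n * (h ^ 2 * M ^ 2) := by
      refine mul_le_mul_of_nonneg_right ?_ (by positivity)
      push_cast at hkn' ⊢
      linarith [hs.2]
    have h5 := mul_le_mul_of_nonneg_right hε2 hpos.le
    linarith
  have hlin' : ∀ x ∈ K, ∀ y ∈ K, ‖y - x‖ ≤ ρ →
      ‖φ h y - φ h x - B x (y - x)‖ ≤ h * ε * ‖y - x‖ := by
    intro x hx y hy hxy
    rw [mul_comm h ε]
    exact hlin h hpos.le hle₂ x hx y hy hxy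
  have hlip : ∀ x ∈ K, ∀ y ∈ K, ‖y - x‖ ≤ ρ → ‖φ h y - φ h x‖ ≤ (1 + h * L) * ‖y - x‖ := by
    intro x hx y hy hxy
    have h1 := norm_sub_norm_le (φ h y - φ h x) (B x (y - x))
    have h2 := hlin' x hx y hy hxy
    have h3 := hBle x hx (y - x)
    have h4 : h * ε * ‖y - x‖ ≤ h * 1 * ‖y - x‖ := by gcongr
    rw [hL]
    linarith
  have hiter := fun x (hx : x ∈ K) => exists_iterate_linearization (s := s) (ψ := φ h)
    (fun x hx => hφK x hx h)
    (by linarith [mul_pos hpos hLpos] : 1 ≤ 1 + h * L) (by positivity) (by positivity)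
    hBq hBc hG₀ hG₁ hb hlip hlin' N hx
  have hiterK : ∀ x ∈ K, (φ h)^[N] x ∈ K := fun x hx =>
    Set.MapsTo.iterate (f := φ h) (fun x hx => hφK x hx h) N hx
  have honto : K ⊆ (φ h)^[N] '' K := by
    have : Set.SurjOn (φ h) K K := (hφonto h).ge
    exact this.iterate N
  have hqN : (1 + h * L) ^ N ≤ Real.exp (L * T) := by
    have h1 : 1 + h * L ≤ Real.exp (h * L) := by linarith [Real.add_one_le_exp (h * L)]
    refine (pow_le_pow_left₀ (by positivity) h1 N).trans_eq ?_
    rw [← Real.exp_nat_mul, ← hNh]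
    ring_nf
  have hcN : (1 + 2 * (h * L)) ^ N ≤ Real.exp (2 * L * T) := by
    have h1 : 1 + 2 * (h * L) ≤ Real.exp (2 * (h * L)) := by
      linarith [Real.add_one_le_exp (2 * (h * L))]
    refine (pow_le_pow_left₀ (by positivity) h1 N).trans_eq ?_
    rw [← Real.exp_nat_mul, ← hNh]
    ring_nf
  refine ⟨(φ h)^[N], hiterK, honto, ρ * Real.exp (-(L * T)), by positivity,
    Real.exp (-(2 * L * T)), Real.exp_pos _, fun p hp => ?_⟩
  obtain ⟨A, a₀, a₁, hA, hA₀, hA₁, ha, hAy⟩ := hiter p hp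
  rw [← mul_assoc, hNh] at ha
  refine ⟨A, a₀, a₁, fun w => ?_, hA₀, hA₁, ha, fun y hy hyr => ?_⟩
  · have h1 : ‖w‖ ≤ Real.exp (2 * L * T) * ‖A w‖ :=
      (hA w).trans (mul_le_mul_of_nonneg_right hcN (norm_nonneg _))
    rw [Real.exp_neg, inv_mul_le_iff₀ (Real.exp_pos _)]
    exact h1
  · have h1 : (1 + h * L) ^ N * ‖y - p‖ ≤ ρ := by
      have h2 : (1 + h * L) ^ N * ‖y - p‖ ≤
          Real.exp (L * T) * (ρ * Real.exp (-(L * T))) :=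
        mul_le_mul hqN hyr (norm_nonneg _) (Real.exp_pos _).le
      have h3 : Real.exp (L * T) * (ρ * Real.exp (-(L * T))) = ρ := by
        rw [Real.exp_neg]; field_simp
      linarith
    refine (hAy y hy h1).2.trans (mul_le_mul_of_nonneg_right ?_ (norm_nonneg _))
    have h4 : (N : ℝ) * (h * ε) = T * ε := by rw [← mul_assoc, hNh]
    rw [h4]
    refine (mul_le_mul hε3 hqN (by positivity) (Real.exp_pos _).le).trans_eq ?_
    rw [← Real.exp_add]
    ring_nf

/-- The dimension bound under a uniformly negative version of the eigenvalue condition. -/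
theorem dimH_le_of_sum_add_fderiv_le_neg {n k : ℕ} (hkn : k < n) {s : ℝ}
    (hs : s ∈ Set.Icc (0 : ℝ) 1) (hd : 0 < k + s)
    {U K : Set (EuclideanSpace ℝ (Fin n))} (hU : IsOpen U) (hK : IsCompact K) (hKU : K ⊆ U)
    {f : EuclideanSpace ℝ (Fin n) → EuclideanSpace ℝ (Fin n)} (hf : ContDiffOn ℝ 1 f U)
    {φ : ℝ → EuclideanSpace ℝ (Fin n) → EuclideanSpace ℝ (Fin n)} (hφ0 : ∀ x ∈ K, φ 0 x = x)
    (hφK : ∀ x ∈ K, ∀ t : ℝ, φ t x ∈ K)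
    (hφd : ∀ x ∈ K, ∀ t : ℝ, HasDerivAt (fun s => φ s x) (f (φ t x)) t)
    (hφonto : ∀ t : ℝ, φ t '' K = K)
    {v : EuclideanSpace ℝ (Fin n) → ℝ} (hv : ContDiffOn ℝ 1 v U)
    {L₀ L₁ : EuclideanSpace ℝ (Fin n) → ℝ}
    (hL₀ : ∀ x ∈ K, ∀ q : Fin k → EuclideanSpace ℝ (Fin n), Orthonormal ℝ q →
      ∑ a, 2 * inner ℝ (q a) (fderiv ℝ f x (q a)) ≤ L₀ x)
    (hL₁ : ∀ x ∈ K, ∀ q : Fin (k + 1) → EuclideanSpace ℝ (Fin n), Orthonormal ℝ q →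
      ∑ a, 2 * inner ℝ (q a) (fderiv ℝ f x (q a)) ≤ L₁ x)
    {δ : ℝ} (hδ : 0 < δ)
    (hcond : ∀ x ∈ K, (1 - s) * L₀ x + s * L₁ x + fderiv ℝ v x (f x) ≤ -δ) :
    dimH K ≤ ENNReal.ofReal (k + s) := by
  have hn : (0 : ℝ) < n := by exact_mod_cast (Nat.zero_le k).trans_lt hkn
  obtain ⟨V', hV'⟩ := hK.exists_bound_of_continuousOn (hv.continuousOn.mono hKU)
  set V := |V'| with hVdef
  have hV : ∀ x ∈ K, |v x| ≤ V := fun x hx => (hV' x hx).trans (le_abs_self _)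
  obtain ⟨τ, hτ⟩ : ∃ τ : ℝ, (16 * n : ℝ) ^ n * Real.exp (-τ / 2) ≤ 1 / 2 := by
    refine ⟨2 * Real.log (2 * (16 * n : ℝ) ^ n), ?_⟩
    rw [show -(2 * Real.log (2 * (16 * n : ℝ) ^ n)) / 2 = -Real.log (2 * (16 * n : ℝ) ^ n) by
      ring, Real.exp_neg, Real.exp_log (by positivity)]
    field_simp
    rfl
  obtain ⟨T, hT0, hT⟩ : ∃ T : ℝ, 0 < T ∧ 2 * V - T * (δ / 2) ≤ -τ := by
    refine ⟨(2 * V + |τ| + 1) * 2 / δ, by positivity, ?_⟩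
    have : (2 * V + |τ| + 1) * 2 / δ * (δ / 2) = 2 * V + |τ| + 1 := by field_simp
    rw [this]
    linarith [le_abs_self τ]
  obtain ⟨ψ, hψK, honto, r₀, hr₀, m, hm, hψ⟩ := exists_long_time_linearization hkn hs hU hK hKU
    hf hφ0 hφK hφd hφonto hv hL₀ hL₁ hδ hcond hT0
  have hdpos : 0 < Real.toNNReal (k + s) := Real.toNNReal_pos.mpr hd
  have hdcoe : ((Real.toNNReal (k + s) : NNReal) : ℝ) = k + s := Real.coe_toNNReal _ hd.le
  refine dimH_le_of_contracting_covers hK honto hdpos hr₀ fun p hp r hr hrr => ?_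
  obtain ⟨A, a₀, a₁, hA, hA₀, hA₁, ha, hAy⟩ := hψ p hp
  obtain ⟨t, ht1, ht2, ht3⟩ := exists_finset_cover hkn hs A hm hA hA₀ hA₁
    (ψ '' (K ∩ Metric.closedBall p r)) (ψ p) hr (by
      rintro _ ⟨y, ⟨hy, hyr⟩, rfl⟩
      rw [mem_closedBall_iff_norm] at hyr
      exact ⟨y - p, hyr, (hAy y hy (hyr.trans hrr)).trans (mul_le_mul_of_nonneg_left hyr hm.le)⟩)
  have hsub : ψ '' (K ∩ Metric.closedBall p r) ⊆ K := by
    rintro _ ⟨y, hy, rfl⟩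
    exact hψK y hy.1
  refine ⟨t, fun c hc => ⟨hsub (ht1 c hc).1, (ht1 c hc).2⟩, Set.inter_subset_right.trans ht2, ?_⟩
  rw [hdcoe]
  refine ht3.trans (mul_le_mul_of_nonneg_right ?_ (Real.rpow_nonneg hr.le _))
  refine le_trans (mul_le_mul_of_nonneg_left (Real.exp_le_exp.mpr ?_) (by positivity)) hτ
  have e2 := (abs_le.mp (hV p hp)).2
  have e3 := (abs_le.mp (hV _ (hψK p hp))).1
  linarith

/-- The sum of the `j` largest eigenvalues of `Df + Dfᵀ` is continuous. -/
theorem continuousOn_sum_eigenvalues {n j : ℕ} (hj : j ≤ n) {U : Set (EuclideanSpace ℝ (Fin n))}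
    {f : EuclideanSpace ℝ (Fin n) → EuclideanSpace ℝ (Fin n)}
    (hf : ContinuousOn (fderiv ℝ f) U) {lam : EuclideanSpace ℝ (Fin n) → Fin n → ℝ}
    (hlam_eig : ∀ x ∈ U,
      (jacobian f x + (jacobian f x)ᵀ).charpoly =
        ∏ i : Fin n, (Polynomial.X - Polynomial.C (lam x i)))
    (hlam_dec : ∀ x ∈ U, Antitone (lam x)) :
    ContinuousOn (fun x => ∑ i : Fin j, lam x (Fin.castLE hj i)) U := by
  have key : ∀ x ∈ U, ∀ y ∈ U, ∑ i : Fin j, lam y (Fin.castLE hj i) ≤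
      ∑ i : Fin j, lam x (Fin.castLE hj i) + 2 * j * ‖fderiv ℝ f y - fderiv ℝ f x‖ := by
    intro x hx y hy
    obtain ⟨b, hb⟩ :=
      exists_orthonormalBasis_two_mul_inner_fderiv f x (lam x) (hlam_dec x hx) (hlam_eig x hx)
    obtain ⟨c, hc⟩ :=
      exists_orthonormalBasis_two_mul_inner_fderiv f y (lam y) (hlam_dec y hy) (hlam_eig y hy)
    have hq : Orthonormal ℝ fun a : Fin j => c (Fin.castLE hj a) :=
      c.orthonormal.comp _ (Fin.castLE_injective hj)
    have h1 := sum_inner_le_sum_eigenvalues hj (hlam_dec x hx) b hb hq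
    have h2 := sum_inner_eq_sum_eigenvalues hj c hc
    rw [← h2]
    have h3 : ∀ a : Fin j, 2 * inner ℝ (c (Fin.castLE hj a)) (fderiv ℝ f y (c (Fin.castLE hj a))) ≤
        2 * inner ℝ (c (Fin.castLE hj a)) (fderiv ℝ f x (c (Fin.castLE hj a))) +
          2 * ‖fderiv ℝ f y - fderiv ℝ f x‖ := by
      intro a
      set u := c (Fin.castLE hj a) with hu
      have hu1 : ‖u‖ = 1 := c.orthonormal.1 _
      have h4 : inner ℝ u ((fderiv ℝ f y - fderiv ℝ f x) u) ≤ ‖fderiv ℝ f y - fderiv ℝ f x‖ := by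
        refine (real_inner_le_norm _ _).trans ?_
        have := (fderiv ℝ f y - fderiv ℝ f x).le_opNorm u
        rw [hu1] at this ⊢
        linarith
      rw [_root_.sub_apply, inner_sub_right] at h4
      linarith
    refine (Finset.sum_le_sum fun a _ => h3 a).trans ?_
    rw [Finset.sum_add_distrib]
    simp only [Finset.sum_const, Finset.card_univ, Fintype.card_fin, nsmul_eq_mul]
    linarith
  intro x hx
  have h0 : Tendsto (fun y => 2 * j * ‖fderiv ℝ f y - fderiv ℝ f x‖) (𝓝[U] x) (𝓝 0) := by
    have := ((hf x hx).sub (continuousWithinAt_const (b := fderiv ℝ f x))).norm.const_mul (2 * j : ℝ)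
    simpa [ContinuousWithinAt] using this
  refine tendsto_iff_dist_tendsto_zero.mpr
    (squeeze_zero' (Eventually.of_forall fun _ => dist_nonneg) ?_ h0)
  filter_upwards [self_mem_nhdsWithin] with y hy
  have h1 := key x hx y hy
  have h2 := key y hy x hx
  rw [norm_sub_rev] at h2
  rw [Real.dist_eq, abs_le]
  constructor <;> linarith

/-- Leonov: let `f` be `C¹` on an open set `U` and, for `x ∈ U`, let
`lam x 0 ≥ lam x 1 ≥ … ≥ lam x (n-1)` be the eigenvalues (with multiplicity, in decreasing
order, i.e. the roots of the characteristic polynomial) of the symmetric matrix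
`Df(x) + Df(x)ᵀ`.  If `K ⊆ U` is a compact set invariant under the flow of `f` and there is
a `C¹` function `v : U → ℝ` with
`λ₁(x) + ⋯ + λ_k(x) + s·λ_{k+1}(x) + ⟨∇v(x), f(x)⟩ < 0` on `U` for some `1 ≤ k < n`,
`s ∈ [0,1]`, then `dim_H K < k + s`.  (Here `⟨∇v(x), f(x)⟩ = Dv(x)[f(x)]`.) -/
theorem hausdorff_dimension_lt_of_eigenvalue_condition_with_lyapunov_function {n : ℕ}
    (U : Set (EuclideanSpace ℝ (Fin n))) (hU : IsOpen U)
    (f : EuclideanSpace ℝ (Fin n) → EuclideanSpace ℝ (Fin n))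
    (hf : ContDiffOn ℝ 1 f U)
    (lam : EuclideanSpace ℝ (Fin n) → Fin n → ℝ)
    (hlam_eig : ∀ x ∈ U,
      (jacobian f x + (jacobian f x)ᵀ).charpoly =
        ∏ i : Fin n, (Polynomial.X - Polynomial.C (lam x i)))
    (hlam_dec : ∀ x ∈ U, Antitone (lam x))
    (K : Set (EuclideanSpace ℝ (Fin n))) (hK : IsCompact K) (hKU : K ⊆ U)
    (φ : ℝ → EuclideanSpace ℝ (Fin n) → EuclideanSpace ℝ (Fin n))
    (hφ0 : ∀ x ∈ K, φ 0 x = x)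
    (hφK : ∀ x ∈ K, ∀ t : ℝ, φ t x ∈ K)
    (hφd : ∀ x ∈ K, ∀ t : ℝ, HasDerivAt (fun s => φ s x) (f (φ t x)) t)
    (hφonto : ∀ t : ℝ, φ t '' K = K)
    (v : EuclideanSpace ℝ (Fin n) → ℝ) (hv : ContDiffOn ℝ 1 v U)
    (k : ℕ) (hk1 : 1 ≤ k) (hkn : k < n) (s : ℝ) (hs : s ∈ Set.Icc (0 : ℝ) 1)
    (hcond : ∀ x ∈ U,
      (∑ i : Fin k, lam x (Fin.castLE hkn.le i)) + s * lam x ⟨k, hkn⟩ +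
        fderiv ℝ v x (f x) < 0) :
    dimH K < (k : ENNReal) + ENNReal.ofReal s := by
  have hk0 : (1 : ℝ) ≤ k := by exact_mod_cast hk1
  have htarget : (k : ENNReal) + ENNReal.ofReal s = ENNReal.ofReal (k + s) := by
    rw [ENNReal.ofReal_add (by linarith) hs.1, ENNReal.ofReal_natCast]
  rw [htarget]
  have hfd := hf.continuousOn_fderiv_of_isOpen hU le_rfl
  have hcont : ∀ j (hj : j ≤ n),
      ContinuousOn (fun x => ∑ i : Fin j, lam x (Fin.castLE hj i)) K := fun j hj =>
    (continuousOn_sum_eigenvalues hj hfd hlam_eig hlam_dec).mono hKU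
  have hsucc : ∀ j (hj : j + 1 ≤ n) x, ∑ i : Fin (j + 1), lam x (Fin.castLE hj i) =
      ∑ i : Fin j, lam x (Fin.castLE (Nat.le_of_succ_le hj) i) + lam x ⟨j, hj⟩ := fun j hj x =>
    Fin.sum_univ_castSucc _
  have hlamc : ∀ j (hj : j < n), ContinuousOn (fun x => lam x ⟨j, hj⟩) K := by
    intro j hj
    refine ((hcont (j + 1) hj).sub (hcont j hj.le)).congr fun x _ => ?_
    simp only [Pi.sub_apply, hsucc j hj x]
    ring
  have hkyfan : ∀ j (hj : j ≤ n), ∀ x ∈ K, ∀ q : Fin j → EuclideanSpace ℝ (Fin n),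
      Orthonormal ℝ q → ∑ a, 2 * inner ℝ (q a) (fderiv ℝ f x (q a)) ≤
        ∑ i : Fin j, lam x (Fin.castLE hj i) := by
    intro j hj x hx q hq
    have hxU := hKU hx
    obtain ⟨b, hb⟩ :=
      exists_orthonormalBasis_two_mul_inner_fderiv f x (lam x) (hlam_dec x hxU) (hlam_eig x hxU)
    exact sum_inner_le_sum_eigenvalues hj (hlam_dec x hxU) b hb hq
  set G : EuclideanSpace ℝ (Fin n) → ℝ := fun x =>
    (∑ i : Fin k, lam x (Fin.castLE hkn.le i)) + s * lam x ⟨k, hkn⟩ + fderiv ℝ v x (f x) with hG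
  have hGc : ContinuousOn G K :=
    ((hcont k hkn.le).add ((hlamc k hkn).const_smul s)).add
      (((hv.continuousOn_fderiv_of_isOpen hU le_rfl).clm_apply hf.continuousOn).mono hKU)
  obtain ⟨δ, hδ, hGδ⟩ : ∃ δ > 0, ∀ x ∈ K, G x ≤ -δ := by
    rcases K.eq_empty_or_nonempty with rfl | hne
    · exact ⟨1, one_pos, by simp⟩
    · obtain ⟨x₀, hx₀, hmax⟩ := hK.exists_isMaxOn hne hGc
      exact ⟨-G x₀, neg_pos.mpr (hcond x₀ (hKU hx₀)), fun x hx => by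
        rw [neg_neg]; exact hmax hx⟩
  have hsmall : ∀ j (hj : j < n), ∀ c : ℝ, 0 < c →
      ∃ e, 0 < e ∧ e ≤ c ∧ ∀ x ∈ K, -(e * lam x ⟨j, hj⟩) ≤ δ / 2 := by
    intro j hj c hc
    obtain ⟨C, hC⟩ := hK.exists_bound_of_continuousOn (hlamc j hj)
    refine ⟨min c (δ / (2 * (|C| + 1))), by positivity, min_le_left _ _, fun x hx => ?_⟩
    have he : min c (δ / (2 * (|C| + 1))) ≤ δ / (2 * (|C| + 1)) := min_le_right _ _
    have he0 : 0 < min c (δ / (2 * (|C| + 1))) := by positivity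
    rw [le_div_iff₀ (by positivity)] at he
    have h1 := (abs_le.mp ((hC x hx).trans (le_abs_self C))).1
    nlinarith
  rcases hs.1.eq_or_lt with h0 | h0
  · obtain ⟨k, rfl⟩ : ∃ j, k = j + 1 := ⟨k - 1, by omega⟩
    obtain ⟨e, he, he1, heK⟩ := hsmall k (by omega) (1 / 2) (by norm_num)
    have := dimH_le_of_sum_add_fderiv_le_neg (k := k) (s := 1 - e) (by omega)
      ⟨by linarith, by linarith⟩ (by linarith [Nat.cast_nonneg (α := ℝ) k]) hU hK hKU hf hφ0 hφK
      hφd hφonto hv (hkyfan k (by omega)) (hkyfan (k + 1) hkn.le) (half_pos hδ) (by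
        intro x hx
        have h1 := hGδ x hx
        have h2 := heK x hx
        simp only [hG] at h1
        rw [hsucc k] at h1 ⊢
        rw [← h0] at h1
        linarith)
    refine this.trans_lt ((ENNReal.ofReal_lt_ofReal_iff (by linarith)).mpr ?_)
    push_cast
    linarith
  · obtain ⟨e, he, he1, heK⟩ := hsmall k hkn s h0
    have := dimH_le_of_sum_add_fderiv_le_neg (s := s - e) hkn
      ⟨by linarith, by linarith [hs.2]⟩ (by linarith) hU hK hKU hf hφ0 hφK
      hφd hφonto hv (hkyfan k hkn.le) (hkyfan (k + 1) hkn) (half_pos hδ) (by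
        intro x hx
        have h1 := hGδ x hx
        have h2 := heK x hx
        simp only [hG] at h1
        rw [hsucc k hkn]
        linarith)
    refine this.trans_lt ((ENNReal.ofReal_lt_ofReal_iff (by linarith)).mpr ?_)
    linarith
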